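/- Completeness of the conjunction-disjunction fragment with respect to the two-element algebra: for all Γ ∪ {φ} ⊆ 𝔉_{{∧,∨}} (formulas built from letters using only ∧ and ∨), Γ ⊢_{{∧,∨}} φ if and only if Γ ⊨_𝟐 φ, where 𝟐 is the two-element lattice {0,1} with the usual meet and join and designated set D = {1}. -/

import Mathlib

/-- The four propositional connectives. -/
inductive Conn : Type
  | conj | disj | impl | nega
deriving DecidableEq

/-- Propositional formulas over countably many letters `p₀, p₁, …`. -/
inductive PropForm : Type
  | var : ℕ → PropForm
  | and : PropForm → PropForm → PropForm
  | or : PropForm → PropForm → PropForm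
  | imp : PropForm → PropForm → PropForm
  | neg : PropForm → PropForm

/-- The set of connectives occurring in a formula. -/
def PropForm.conns : PropForm → Set Conn
  | .var _ => ∅
  | .and a b => insert .conj (a.conns ∪ b.conns)
  | .or a b => insert .disj (a.conns ∪ b.conns)
  | .imp a b => insert .impl (a.conns ∪ b.conns)
  | .neg a => insert .nega a.conns

/-- `φ ∈ 𝔉_F` : the formula `φ` uses only connectives belonging to the fragment `F`. -/
def InFrag (F : Set Conn) (φ : PropForm) : Prop := φ.conns ⊆ F

/-- Derivability `Γ ⊢_F φ` for the fragment `F`: the least relation closed under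
membership, monotonicity, cut, and the two directions of the rules
(R∧), (R∨), (R→), (R¬I), (R¬E) for the connectives in `F`. -/
inductive Deriv (F : Set Conn) : Set PropForm → PropForm → Prop
  | mem {Γ : Set PropForm} {φ : PropForm} : φ ∈ Γ → Deriv F Γ φ
  | mono {Γ : Set PropForm} {φ ψ : PropForm} : Deriv F Γ φ → Deriv F (insert ψ Γ) φ
  | cut {Γ Δ : Set PropForm} {φ ψ : PropForm} :
      Deriv F Γ φ → Deriv F (insert φ Δ) ψ → Deriv F (Γ ∪ Δ) ψ
  | andI {Γ : Set PropForm} {φ ψ : PropForm} :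
      Conn.conj ∈ F → Deriv F Γ φ → Deriv F Γ ψ → Deriv F Γ (.and φ ψ)
  | andE1 {Γ : Set PropForm} {φ ψ : PropForm} :
      Conn.conj ∈ F → Deriv F Γ (.and φ ψ) → Deriv F Γ φ
  | andE2 {Γ : Set PropForm} {φ ψ : PropForm} :
      Conn.conj ∈ F → Deriv F Γ (.and φ ψ) → Deriv F Γ ψ
  | orI {Γ : Set PropForm} {φ ψ χ : PropForm} :
      Conn.disj ∈ F → Deriv F (insert φ Γ) χ → Deriv F (insert ψ Γ) χ →
      Deriv F (insert (.or φ ψ) Γ) χ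
  | orE1 {Γ : Set PropForm} {φ ψ χ : PropForm} :
      Conn.disj ∈ F → Deriv F (insert (.or φ ψ) Γ) χ → Deriv F (insert φ Γ) χ
  | orE2 {Γ : Set PropForm} {φ ψ χ : PropForm} :
      Conn.disj ∈ F → Deriv F (insert (.or φ ψ) Γ) χ → Deriv F (insert ψ Γ) χ
  | impI {Γ : Set PropForm} {φ ψ : PropForm} :
      Conn.impl ∈ F → Deriv F (insert φ Γ) ψ → Deriv F Γ (.imp φ ψ)
  | impE {Γ : Set PropForm} {φ ψ : PropForm} :
      Conn.impl ∈ F → Deriv F Γ (.imp φ ψ) → Deriv F (insert φ Γ) ψ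
  | negI {Γ : Set PropForm} {φ ψ : PropForm} :
      Conn.nega ∈ F → Deriv F (insert φ Γ) ψ → Deriv F (insert φ Γ) (.neg ψ) →
      Deriv F Γ (.neg φ)
  | negE {Γ : Set PropForm} {φ ψ : PropForm} :
      Conn.nega ∈ F → Deriv F Γ φ → Deriv F Γ (.neg φ) → Deriv F Γ ψ

/-- An algebra interpreting the connectives on a carrier `V`. -/
structure Alg (V : Type) where
  and : V → V → V
  or : V → V → V
  imp : V → V → V
  neg : V → V

/-- The homomorphic extension of an assignment `v` of letters. -/
def Alg.eval {V : Type} (A : Alg V) (v : ℕ → V) : PropForm → V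
  | .var n => v n
  | .and a b => A.and (A.eval v a) (A.eval v b)
  | .or a b => A.or (A.eval v a) (A.eval v b)
  | .imp a b => A.imp (A.eval v a) (A.eval v b)
  | .neg a => A.neg (A.eval v a)

/-- Semantic consequence `Γ ⊨_{A,D} φ`. -/
def SemConseq {V : Type} (A : Alg V) (D : Set V) (Γ : Set PropForm) (φ : PropForm) : Prop :=
  ∀ v : ℕ → V, (∀ ψ ∈ Γ, A.eval v ψ ∈ D) → A.eval v φ ∈ D

/-- The fragment `F` has a finite semantics. -/
def HasFiniteSemantics (F : Set Conn) : Prop :=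
  ∃ (V : Type) (_ : Fintype V) (A : Alg V) (D : Set V),
    ∀ (Γ : Set PropForm) (φ : PropForm),
      (∀ ψ ∈ Γ, InFrag F ψ) → InFrag F φ →
      (Deriv F Γ φ ↔ SemConseq A D Γ φ)

/-- `φ ∨̇ ψ = (φ → ψ) → ψ`. -/
def dvee (a b : PropForm) : PropForm := .imp (.imp a b) b

/-- Left-associated iterated `∨̇` of a list of formulas. -/
def bigDvee : List PropForm → PropForm
  | [] => .var 0
  | a :: rest => rest.foldl dvee a

/-- Left-associated iterated `∨` of a list of formulas. -/
def bigOrF : List PropForm → PropForm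
  | [] => .var 0
  | a :: rest => rest.foldl PropForm.or a

/-- All pairs `(i, j)` with `1 ≤ i < j ≤ n+1`. -/
def pairs (n : ℕ) : List (ℕ × ℕ) :=
  (List.range' 2 n).flatMap fun j => (List.range' 1 (j - 1)).map fun i => (i, j)

/-- `α_n = ∨̇_{1 ≤ i < j ≤ n+1} (p_j → p_i)`. -/
def alphaImp (n : ℕ) : PropForm :=
  bigDvee ((pairs n).map fun p => .imp (.var p.2) (.var p.1))

/-- `α_n = ⋁_{1 ≤ i < j ≤ n+1} ¬¬(¬p_i ∨ p_j)`. -/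
def alphaOrNeg (n : ℕ) : PropForm :=
  bigOrF ((pairs n).map fun p => .neg (.neg (.or (.neg (.var p.1)) (.var p.2))))

/-- Two-valued Boolean evaluation. -/
def evalBool (v : ℕ → Bool) : PropForm → Bool
  | .var n => v n
  | .and a b => evalBool v a && evalBool v b
  | .or a b => evalBool v a || evalBool v b
  | .imp a b => !evalBool v a || evalBool v b
  | .neg a => !evalBool v a

/-- Classical (two-valued) consequence `Γ ⊢_c φ`. -/
def ClassConseq (Γ : Set PropForm) (φ : PropForm) : Prop :=
  ∀ v : ℕ → Bool, (∀ ψ ∈ Γ, evalBool v ψ = true) → evalBool v φ = true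

/-- The two-element Boolean algebra `𝟐`. -/
def alg2 : Alg Bool where
  and a b := a && b
  or a b := a || b
  imp a b := !a || b
  neg a := !a

/-- The three-element algebra `𝟑` on the chain `0 < 1/2 < 1` (coded as `0 < 1 < 2` in `Fin 3`),
with meet `min` and meet complement `¬0 = 1`, `¬(1/2) = ¬1 = 0` (its `or`/`imp` are those of the
3-element Heyting chain). -/
def alg3 : Alg (Fin 3) where
  and a b := min a b
  or a b := max a b
  imp a b := if a ≤ b then 2 else b
  neg a := if a = 0 then 2 else 0

/-- The `(n+1)`-element Heyting chain, coded on `Fin (n+1)` (so `k` codes the element `k+1`). -/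
def chainAlg (n : ℕ) : Alg (Fin (n + 1)) where
  and a b := min a b
  or a b := max a b
  imp a b := if a ≤ b then Fin.last n else b
  neg a := if a = 0 then Fin.last n else 0

namespace Deriv

variable {F : Set Conn} {Γ Δ : Set PropForm} {φ ψ χ : PropForm}

theorem weaken (h : Deriv F Γ φ) (hΓ : Γ ⊆ Δ) : Deriv F Δ φ := by
  simpa [Set.union_eq_self_of_subset_left hΓ] using
    h.cut (Δ := Δ) (mem (Set.mem_insert φ Δ))

theorem trans (h : Deriv F Γ φ) (h' : Deriv F (insert φ Γ) ψ) : Deriv F Γ ψ := by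
  simpa using h.cut h'

theorem or_left (hF : Conn.disj ∈ F) (h : Deriv F Γ φ) : Deriv F Γ (.or φ ψ) :=
  h.trans (orE1 (ψ := ψ) hF (mem (Set.mem_insert _ _)))

theorem or_right (hF : Conn.disj ∈ F) (h : Deriv F Γ ψ) : Deriv F Γ (.or φ ψ) :=
  h.trans (orE2 (φ := φ) hF (mem (Set.mem_insert _ _)))

theorem exists_finite_insert
    (h : ∃ S ⊆ insert φ Γ, S.Finite ∧ Deriv F S ψ) :
    ∃ S ⊆ Γ, S.Finite ∧ Deriv F (insert φ S) ψ := by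
  obtain ⟨S, hS, hfin, hd⟩ := h
  exact ⟨S \ {φ}, by grind, hfin.sdiff, hd.weaken (by grind)⟩

/-- Derivability is finitary. -/
theorem exists_finite (h : Deriv F Γ φ) : ∃ S ⊆ Γ, S.Finite ∧ Deriv F S φ := by
  induction h with
  | @mem Γ φ h => exact ⟨{φ}, by simpa using h, Set.finite_singleton _, mem rfl⟩
  | mono _ ih =>
    obtain ⟨S, hS, hfin, hd⟩ := ih
    exact ⟨S, hS.trans (Set.subset_insert _ _), hfin, hd⟩
  | cut _ _ ih₁ ih₂ =>
    obtain ⟨S, hS, hfS, hdS⟩ := ih₁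
    obtain ⟨T, hT, hfT, hdT⟩ := exists_finite_insert ih₂
    exact ⟨S ∪ T, Set.union_subset_union hS hT, hfS.union hfT, hdS.cut hdT⟩
  | andI hF _ _ ih₁ ih₂ =>
    obtain ⟨S, hS, hfS, hdS⟩ := ih₁
    obtain ⟨T, hT, hfT, hdT⟩ := ih₂
    exact ⟨S ∪ T, Set.union_subset hS hT, hfS.union hfT,
      andI hF (hdS.weaken Set.subset_union_left) (hdT.weaken Set.subset_union_right)⟩
  | andE1 hF _ ih =>
    obtain ⟨S, hS, hfin, hd⟩ := ih
    exact ⟨S, hS, hfin, andE1 hF hd⟩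
  | andE2 hF _ ih =>
    obtain ⟨S, hS, hfin, hd⟩ := ih
    exact ⟨S, hS, hfin, andE2 hF hd⟩
  | orI hF _ _ ih₁ ih₂ =>
    obtain ⟨S, hS, hfS, hdS⟩ := exists_finite_insert ih₁
    obtain ⟨T, hT, hfT, hdT⟩ := exists_finite_insert ih₂
    exact ⟨_, Set.insert_subset_insert (Set.union_subset hS hT), (hfS.union hfT).insert _,
      orI hF (hdS.weaken (Set.insert_subset_insert Set.subset_union_left))
        (hdT.weaken (Set.insert_subset_insert Set.subset_union_right))⟩
  | orE1 hF _ ih =>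
    obtain ⟨S, hS, hfin, hd⟩ := exists_finite_insert ih
    exact ⟨_, Set.insert_subset_insert hS, hfin.insert _, orE1 hF hd⟩
  | orE2 hF _ ih =>
    obtain ⟨S, hS, hfin, hd⟩ := exists_finite_insert ih
    exact ⟨_, Set.insert_subset_insert hS, hfin.insert _, orE2 hF hd⟩
  | impI hF _ ih =>
    obtain ⟨S, hS, hfin, hd⟩ := exists_finite_insert ih
    exact ⟨S, hS, hfin, impI hF hd⟩
  | impE hF _ ih =>
    obtain ⟨S, hS, hfin, hd⟩ := ih
    exact ⟨_, Set.insert_subset_insert hS, hfin.insert _, impE hF hd⟩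
  | negI hF _ _ ih₁ ih₂ =>
    obtain ⟨S, hS, hfS, hdS⟩ := exists_finite_insert ih₁
    obtain ⟨T, hT, hfT, hdT⟩ := exists_finite_insert ih₂
    exact ⟨S ∪ T, Set.union_subset hS hT, hfS.union hfT,
      negI hF (hdS.weaken (Set.insert_subset_insert Set.subset_union_left))
        (hdT.weaken (Set.insert_subset_insert Set.subset_union_right))⟩
  | negE hF _ _ ih₁ ih₂ =>
    obtain ⟨S, hS, hfS, hdS⟩ := ih₁
    obtain ⟨T, hT, hfT, hdT⟩ := ih₂
    exact ⟨S ∪ T, Set.union_subset hS hT, hfS.union hfT,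
      negE hF (hdS.weaken Set.subset_union_left) (hdT.weaken Set.subset_union_right)⟩

/-- Every derivability relation is sound for the two-element Boolean algebra. -/
theorem semConseq (h : Deriv F Γ φ) : SemConseq alg2 {true} Γ φ := by
  induction h with
  | _ => simp_all [SemConseq, Alg.eval, alg2] <;> grind

/-- A set not deriving `φ` extends to a maximal such set. -/
theorem exists_maximal_not (h : ¬ Deriv F Γ φ) :
    ∃ M, Γ ⊆ M ∧ Maximal (fun Δ ↦ ¬ Deriv F Δ φ) M := by
  have hchar : Order.IsOfFiniteCharacter {Δ | ¬ Deriv F Δ φ} := fun Δ ↦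
    ⟨fun hΔ S hS _ hd ↦ hΔ (hd.weaken hS), fun hΔ hd ↦ by
      obtain ⟨S, hS, hfin, hd⟩ := hd.exists_finite
      exact hΔ S hS hfin hd⟩
  exact hchar.exists_maximal h

end Deriv

section Maximal

variable {F : Set Conn} {M : Set PropForm} {φ ψ χ : PropForm}

theorem deriv_insert_of_maximal (hM : Maximal (fun Δ ↦ ¬ Deriv F Δ φ) M) (hψ : ψ ∉ M) :
    Deriv F (insert ψ M) φ := by
  by_contra h
  exact hψ (hM.le_of_ge h (Set.subset_insert ψ M) (Set.mem_insert ψ M))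

theorem mem_of_deriv_of_maximal (hM : Maximal (fun Δ ↦ ¬ Deriv F Δ φ) M)
    (h : Deriv F M ψ) : ψ ∈ M := by
  by_contra hψ
  exact hM.prop (h.trans (deriv_insert_of_maximal hM hψ))

theorem and_mem_iff_of_maximal (hF : Conn.conj ∈ F)
    (hM : Maximal (fun Δ ↦ ¬ Deriv F Δ φ) M) : PropForm.and ψ χ ∈ M ↔ ψ ∈ M ∧ χ ∈ M :=
  ⟨fun h ↦ ⟨mem_of_deriv_of_maximal hM (.andE1 hF (.mem h)),
      mem_of_deriv_of_maximal hM (.andE2 hF (.mem h))⟩,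
    fun h ↦ mem_of_deriv_of_maximal hM (.andI hF (.mem h.1) (.mem h.2))⟩

theorem or_mem_iff_of_maximal (hF : Conn.disj ∈ F)
    (hM : Maximal (fun Δ ↦ ¬ Deriv F Δ φ) M) : PropForm.or ψ χ ∈ M ↔ ψ ∈ M ∨ χ ∈ M := by
  refine ⟨fun h ↦ ?_, ?_⟩
  · by_contra! hn
    have := Deriv.orI hF (deriv_insert_of_maximal hM hn.1) (deriv_insert_of_maximal hM hn.2)
    rw [Set.insert_eq_of_mem h] at this
    exact hM.prop this
  · rintro (h | h)
    · exact mem_of_deriv_of_maximal hM (.or_left hF (.mem h))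
    · exact mem_of_deriv_of_maximal hM (.or_right hF (.mem h))

open Classical in
/-- In the `{∧, ∨}`-fragment, a maximal set not deriving `φ` is the truth set of an assignment. -/
theorem eval_eq_true_iff_of_maximal
    (hM : Maximal (fun Δ ↦ ¬ Deriv {Conn.conj, Conn.disj} Δ φ) M)
    (hψ : InFrag {Conn.conj, Conn.disj} ψ) :
    alg2.eval (fun n ↦ decide (PropForm.var n ∈ M)) ψ = true ↔ ψ ∈ M := by
  induction ψ with
  | var n => simp [Alg.eval]
  | and a b iha ihb =>
    simp only [InFrag, PropForm.conns, Set.insert_subset_iff, Set.union_subset_iff] at hψ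
    rw [and_mem_iff_of_maximal (by simp) hM, ← iha hψ.2.1, ← ihb hψ.2.2]
    simp [Alg.eval, alg2]
  | or a b iha ihb =>
    simp only [InFrag, PropForm.conns, Set.insert_subset_iff, Set.union_subset_iff] at hψ
    rw [or_mem_iff_of_maximal (by simp) hM, ← iha hψ.2.1, ← ihb hψ.2.2]
    simp [Alg.eval, alg2]
  | imp a b => simp [InFrag, PropForm.conns, Set.insert_subset_iff] at hψ
  | neg a => simp [InFrag, PropForm.conns, Set.insert_subset_iff] at hψ

end Maximal

/-- completeness of the `{∧, ∨}`-fragment w.r.t. the two-element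
lattice `𝟐` with designated set `{1}` (`true`). -/
theorem conj_disj_fragment_two_valued (Γ : Set PropForm) (φ : PropForm)
    (hΓ : ∀ ψ ∈ Γ, InFrag {Conn.conj, Conn.disj} ψ) (hφ : InFrag {Conn.conj, Conn.disj} φ) :
    Deriv {Conn.conj, Conn.disj} Γ φ ↔ SemConseq alg2 {true} Γ φ := by
  refine ⟨Deriv.semConseq, fun h ↦ ?_⟩
  by_contra hd
  obtain ⟨M, hΓM, hM⟩ := Deriv.exists_maximal_not hd
  exact hM.prop (.mem ((eval_eq_true_iff_of_maximal hM hφ).1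
    (h _ fun ψ hψ ↦ (eval_eq_true_iff_of_maximal hM (hΓ ψ hψ)).2 (hΓM hψ))))
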